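/- arXiv:2002.10669 — 2 statements merged into one kernel-verified Lean document; each statement's English description precedes it below -/
import Mathlib

section
/- Fix a real ℓ ≥ 1 and let κ_ℓ := (∫_{1/2}^1 (x(1−x)³)^{ℓ/(ℓ+4)} dx)^{−1} and h̃_ℓ(x) := κ_ℓ·(x^ℓ (1−x)^{2ℓ−4})^{1/(ℓ+4)} for x ∈ [1/2, 1). If h : [1/2, 1) → [0,∞) is continuous, satisfies ∫_{1/2}^1 (1−x)·h(x) dx = 1, and satisfies ∫_{1/2}^1 (x(1−x)²/h(x))^{ℓ/4} dx = ∫_{1/2}^1 (x(1−x)²/h̃_ℓ(x))^{ℓ/4} dx (integrals of the nonnegative objective interpreted in [0,∞]), then h = h̃_ℓ on [1/2, 1). -/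
open MeasureTheory Set
open scoped ENNReal

/-- The normalization constant `κ_ℓ`. -/
noncomputable def kappa (ℓ : ℝ) : ℝ :=
  (∫ x in Set.Ico (1/2 : ℝ) 1, (x * (1 - x) ^ (3:ℕ)) ^ (ℓ / (ℓ + 4)))⁻¹

/-- The optimal derivative `h̃_ℓ(x) = κ_ℓ (x^ℓ (1-x)^{2ℓ-4})^{1/(ℓ+4)}`. -/
noncomputable def hTilde (ℓ : ℝ) : ℝ → ℝ := fun x =>
  kappa ℓ * (x ^ ℓ * (1 - x) ^ (2 * ℓ - 4)) ^ (1 / (ℓ + 4))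

/-- The objective `∫_{1/2}^1 (x(1-x)²/h(x))^{ℓ/4} dx`, valued in `[0,∞]`. -/
noncomputable def objective (ℓ : ℝ) (h : ℝ → ℝ) : ℝ≥0∞ :=
  ∫⁻ x in Set.Ico (1/2 : ℝ) 1,
    (ENNReal.ofReal (x * (1 - x) ^ (2:ℕ)) / ENNReal.ofReal (h x)) ^ (ℓ / 4)

/-- The tangent line inequality for `t ↦ t ^ (-p)` at `1` is strict away from `1`. -/
theorem one_add_lt_rpow_neg_add_mul {p t : ℝ} (hp : 0 < p) (ht : 0 < t) (ht1 : t ≠ 1) :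
    1 + p < t ^ (-p) + p * t := by
  have h1 := Real.log_lt_sub_one_of_pos ht ht1
  have h2 := Real.add_one_le_exp (Real.log t * -p)
  rw [Real.rpow_def_of_pos ht]
  nlinarith

theorem ofReal_div_rpow_add_tangent {A H p a : ℝ} (hA : 0 < A) (hH : 0 < H) (hp : 0 < p)
    (ha : 0 ≤ a) (hne : a ≠ H) :
    ENNReal.ofReal ((1 + p) * (A / H) ^ p) <
      (ENNReal.ofReal A / ENNReal.ofReal a) ^ p + ENNReal.ofReal (p * ((A / H) ^ p * (a / H))) := by
  rcases ha.eq_or_lt with rfl | ha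
  · have hA' : ENNReal.ofReal A ≠ 0 := by simpa using hA
    simp [ENNReal.div_zero hA', ENNReal.top_rpow_of_pos hp]
  · have hT : 0 < (A / H) ^ p := by positivity
    rw [← ENNReal.ofReal_div_of_pos ha, ENNReal.ofReal_rpow_of_pos (by positivity),
      ← ENNReal.ofReal_add (by positivity) (by positivity)]
    refine (ENNReal.ofReal_lt_ofReal_iff (by positivity)).2 ?_
    have hEq : (A / a) ^ p = (A / H) ^ p * (a / H) ^ (-p) := by
      rw [Real.rpow_neg (by positivity), ← Real.inv_rpow (by positivity),
        ← Real.mul_rpow (by positivity) (by positivity)]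
      congr 1
      field_simp
    have key := one_add_lt_rpow_neg_add_mul hp (div_pos ha hH)
      (fun h => hne ((div_eq_one_iff_eq hH.ne').1 h))
    rw [hEq]
    nlinarith

theorem ofReal_div_rpow_self_add_tangent {A H p : ℝ} (hA : 0 < A) (hH : 0 < H) (hp : 0 < p) :
    ENNReal.ofReal ((1 + p) * (A / H) ^ p) =
      (ENNReal.ofReal A / ENNReal.ofReal H) ^ p + ENNReal.ofReal (p * ((A / H) ^ p * (H / H))) := by
  rw [← ENNReal.ofReal_div_of_pos hH, ENNReal.ofReal_rpow_of_pos (by positivity),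
    ← ENNReal.ofReal_add (by positivity) (by positivity), div_self hH.ne']
  congr 1
  ring

theorem integrableOn_rpow_weight {q : ℝ} (hq : 0 ≤ q) :
    IntegrableOn (fun x : ℝ => (x * (1 - x) ^ (3:ℕ)) ^ q) (Ico (1/2 : ℝ) 1) := by
  have hc : Continuous fun x : ℝ => (x * (1 - x) ^ (3:ℕ)) ^ q :=
    (by fun_prop : Continuous fun x : ℝ => x * (1 - x) ^ (3:ℕ)).rpow_const fun _ => Or.inr hq
  exact (hc.integrableOn_Icc (a := 1/2) (b := 1)).mono_set Ico_subset_Icc_self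

theorem kappa_pos {ℓ : ℝ} (hℓ : 0 < ℓ) : 0 < kappa ℓ := by
  refine inv_pos.2 ((setIntegral_pos_iff_support_of_nonneg_ae ?_
    (integrableOn_rpow_weight (by positivity))).2 ?_)
  · filter_upwards [ae_restrict_mem measurableSet_Ico] with x hx
    have h0 : 0 < x := by linarith [hx.1]
    have h1 : 0 < 1 - x := by linarith [hx.2]
    simp only [Pi.zero_apply]
    positivity
  · rw [inter_eq_right.2]
    · simp [Real.volume_Ico]
      norm_num
    · intro x hx
      have h0 : 0 < x := by linarith [hx.1]
      have h1 : 0 < 1 - x := by linarith [hx.2]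
      exact (by positivity : (0:ℝ) < (x * (1 - x) ^ (3:ℕ)) ^ (ℓ / (ℓ + 4))).ne'

theorem hTilde_pos {ℓ x : ℝ} (hℓ : 0 < ℓ) (hx : x ∈ Ico (1/2 : ℝ) 1) : 0 < hTilde ℓ x := by
  have h0 : 0 < x := by linarith [hx.1]
  have h1 : 0 < 1 - x := by linarith [hx.2]
  have := kappa_pos hℓ
  unfold hTilde
  positivity

theorem continuousOn_hTilde {ℓ : ℝ} : ContinuousOn (hTilde ℓ) (Ico (1/2 : ℝ) 1) := by
  have h0 : ∀ x ∈ Ico (1/2 : ℝ) 1, 0 < x := fun x hx => by linarith [hx.1]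
  have h1 : ∀ x ∈ Ico (1/2 : ℝ) 1, 0 < 1 - x := fun x hx => by linarith [hx.2]
  refine continuousOn_const.mul (ContinuousOn.rpow_const ?_ fun x hx => Or.inl ?_)
  · exact (continuousOn_id.rpow_const fun x hx => Or.inl (h0 x hx).ne').mul
      ((by fun_prop : ContinuousOn (fun x : ℝ => 1 - x) _).rpow_const
        fun x hx => Or.inl (h1 x hx).ne')
  · have := h0 x hx
    have := h1 x hx
    positivity

theorem one_sub_mul_hTilde {ℓ x : ℝ} (hℓ : 0 < ℓ) (hx : x ∈ Ico (1/2 : ℝ) 1) :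
    (1 - x) * hTilde ℓ x = kappa ℓ * (x * (1 - x) ^ (3:ℕ)) ^ (ℓ / (ℓ + 4)) := by
  have h0 : 0 < x := by linarith [hx.1]
  have h1 : 0 < 1 - x := by linarith [hx.2]
  unfold hTilde
  generalize 1 - x = y at h1
  have hy : (y ^ (ℓ + 4)) ^ (1 / (ℓ + 4)) = y := by
    rw [← Real.rpow_mul h1.le, mul_one_div_cancel (by positivity), Real.rpow_one]
  have hbase : y ^ (ℓ + 4) * (x ^ ℓ * y ^ (2 * ℓ - 4)) = (x * y ^ (3:ℕ)) ^ ℓ := by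
    rw [Real.mul_rpow h0.le (by positivity), ← Real.rpow_natCast_mul h1.le, mul_left_comm,
      ← Real.rpow_add h1]
    congr 2
    push_cast
    ring
  calc y * (kappa ℓ * (x ^ ℓ * y ^ (2 * ℓ - 4)) ^ (1 / (ℓ + 4)))
      = kappa ℓ * ((y ^ (ℓ + 4)) ^ (1 / (ℓ + 4)) *
          (x ^ ℓ * y ^ (2 * ℓ - 4)) ^ (1 / (ℓ + 4))) := by rw [hy]; ring
    _ = _ := by
      rw [← Real.mul_rpow (by positivity) (by positivity), hbase,
        ← Real.rpow_mul (by positivity), mul_one_div]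

theorem div_hTilde_rpow {ℓ x : ℝ} (hℓ : 0 < ℓ) (hx : x ∈ Ico (1/2 : ℝ) 1) :
    (x * (1 - x) ^ (2:ℕ) / hTilde ℓ x) ^ (ℓ / 4) =
      (kappa ℓ)⁻¹ ^ (ℓ / 4) * (x * (1 - x) ^ (3:ℕ)) ^ (ℓ / (ℓ + 4)) := by
  have h0 : 0 < x := by linarith [hx.1]
  have h1 : 0 < 1 - x := by linarith [hx.2]
  have hκ := kappa_pos hℓ
  have hH := hTilde_pos hℓ hx
  have hB : 0 < x * (1 - x) ^ (3:ℕ) := by positivity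
  have hq : x * (1 - x) ^ (2:ℕ) / hTilde ℓ x =
      (kappa ℓ)⁻¹ * (x * (1 - x) ^ (3:ℕ)) ^ (4 / (ℓ + 4)) := by
    have e : (4 / (ℓ + 4)) = 1 - ℓ / (ℓ + 4) := by field_simp; ring
    have hg : 0 < (x * (1 - x) ^ (3:ℕ)) ^ (ℓ / (ℓ + 4)) := by positivity
    have hm := one_sub_mul_hTilde hℓ hx
    rw [e, Real.rpow_sub hB, Real.rpow_one]
    generalize (x * (1 - x) ^ (3:ℕ)) ^ (ℓ / (ℓ + 4)) = g at *
    rw [← mul_div_assoc, div_eq_div_iff hH.ne' hg.ne']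
    field_simp
    linear_combination -hm
  rw [hq, Real.mul_rpow (by positivity) (by positivity), ← Real.rpow_mul hB.le]
  congr 2
  field_simp

theorem hTilde_unique_minimizer (ℓ : ℝ) (hℓ : 1 ≤ ℓ) (h : ℝ → ℝ)
    (hcont : ContinuousOn h (Set.Ico (1/2 : ℝ) 1))
    (hnonneg : ∀ x ∈ Set.Ico (1/2 : ℝ) 1, 0 ≤ h x)
    (hnorm : (∫ x in Set.Ico (1/2 : ℝ) 1, (1 - x) * h x) = 1)
    (hobj : objective ℓ h = objective ℓ (hTilde ℓ)) :
    ∀ x ∈ Set.Ico (1/2 : ℝ) 1, h x = hTilde ℓ x := by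
  have hℓ0 : 0 < ℓ := by linarith
  have hp : 0 < ℓ / 4 := by positivity
  have hκ := kappa_pos hℓ0
  set A : ℝ → ℝ := fun x => x * (1 - x) ^ (2:ℕ)
  set H := hTilde ℓ
  set T : ℝ → ℝ := fun x => (A x / H x) ^ (ℓ / 4)
  set I : Set ℝ := Ico (1/2 : ℝ) 1
  have hA : ∀ x ∈ I, 0 < A x := fun x hx => by
    have h0 : 0 < x := by linarith [hx.1]
    have h1 : 0 < 1 - x := by linarith [hx.2]
    positivity
  have hH : ∀ x ∈ I, 0 < H x := fun x hx => hTilde_pos hℓ0 hx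
  have hg := integrableOn_rpow_weight (q := ℓ / (ℓ + 4)) (by positivity)
  have hκint : (∫ x in I, (x * (1 - x) ^ (3:ℕ)) ^ (ℓ / (ℓ + 4))) = (kappa ℓ)⁻¹ := by
    rw [kappa, inv_inv]
  have hTint : IntegrableOn T I :=
    IntegrableOn.congr_fun (hg.const_mul ((kappa ℓ)⁻¹ ^ (ℓ / 4)))
      (fun x hx => (div_hTilde_rpow hℓ0 hx).symm) measurableSet_Ico
  have hHnorm : (∫ x in I, (1 - x) * H x) = 1 := by
    rw [setIntegral_congr_fun measurableSet_Ico fun x hx => one_sub_mul_hTilde hℓ0 hx,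
      integral_const_mul, hκint, mul_inv_cancel₀ hκ.ne']
  have hlin : ∀ f : ℝ → ℝ, ∀ x ∈ I, ℓ / 4 * (T x * (f x / H x)) =
      ℓ / 4 * ((kappa ℓ)⁻¹ ^ (ℓ / 4) * (kappa ℓ)⁻¹) * ((1 - x) * f x) := fun f x hx => by
    have hT : T x = (kappa ℓ)⁻¹ ^ (ℓ / 4) * ((kappa ℓ)⁻¹ * ((1 - x) * H x)) := by
      rw [one_sub_mul_hTilde hℓ0 hx, inv_mul_cancel_left₀ hκ.ne']
      exact div_hTilde_rpow hℓ0 hx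
    have := (hH x hx).ne'
    rw [hT]
    field_simp
  have hpen : ∀ f : ℝ → ℝ, (∀ x ∈ I, 0 ≤ f x) → (∫ x in I, (1 - x) * f x) = 1 →
      ∫⁻ x in I, ENNReal.ofReal (ℓ / 4 * (T x * (f x / H x))) =
        ENNReal.ofReal (ℓ / 4 * ((kappa ℓ)⁻¹ ^ (ℓ / 4) * (kappa ℓ)⁻¹)) := fun f hf hf1 => by
    have hint : IntegrableOn (fun x => (1 - x) * f x) I := by
      by_contra hn
      rw [integral_undef hn] at hf1
      exact zero_ne_one hf1
    rw [setLIntegral_congr_fun measurableSet_Ico fun x hx => by rw [hlin f x hx],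
      ← ofReal_integral_eq_lintegral_ofReal (hint.const_mul _), integral_const_mul, hf1, mul_one]
    filter_upwards [ae_restrict_mem measurableSet_Ico] with x hx
    have := hf x hx
    have h1 : 0 < 1 - x := by linarith [hx.2]
    simp only [Pi.zero_apply]
    positivity
  have hmeas : ∀ f : ℝ → ℝ, ContinuousOn f I →
      AEMeasurable (fun x => (ENNReal.ofReal (A x) / ENNReal.ofReal (f x)) ^ (ℓ / 4))
        (volume.restrict I) := fun f hf => by
    have hf' := hf.aemeasurable (μ := volume) measurableSet_Ico
    have hA' : Measurable A := by fun_prop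
    exact (hA'.ennreal_ofReal.aemeasurable.div hf'.ennreal_ofReal).pow_const _
  have hsum : ∀ f : ℝ → ℝ, ContinuousOn f I → (∀ x ∈ I, 0 ≤ f x) →
      (∫ x in I, (1 - x) * f x) = 1 →
      ∫⁻ x in I, ((ENNReal.ofReal (A x) / ENNReal.ofReal (f x)) ^ (ℓ / 4) +
        ENNReal.ofReal (ℓ / 4 * (T x * (f x / H x)))) = objective ℓ f +
        ENNReal.ofReal (ℓ / 4 * ((kappa ℓ)⁻¹ ^ (ℓ / 4) * (kappa ℓ)⁻¹)) := fun f hf hf0 hf1 => by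
    rw [lintegral_add_left' (hmeas f hf), hpen f hf0 hf1]
    rfl
  have htotal : ∫⁻ x in I, ENNReal.ofReal ((1 + ℓ / 4) * T x) = objective ℓ H +
      ENNReal.ofReal (ℓ / 4 * ((kappa ℓ)⁻¹ ^ (ℓ / 4) * (kappa ℓ)⁻¹)) := by
    rw [← hsum H continuousOn_hTilde (fun x hx => (hH x hx).le) hHnorm]
    exact setLIntegral_congr_fun measurableSet_Ico fun x hx =>
      ofReal_div_rpow_self_add_tangent (hA x hx) (hH x hx) hp
  have hTmeas : AEMeasurable T (volume.restrict I) := hTint.aemeasurable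
  have hle : (fun x => ENNReal.ofReal ((1 + ℓ / 4) * T x)) ≤ᵐ[volume.restrict I] fun x =>
      (ENNReal.ofReal (A x) / ENNReal.ofReal (h x)) ^ (ℓ / 4) +
        ENNReal.ofReal (ℓ / 4 * (T x * (h x / H x))) := by
    filter_upwards [ae_restrict_mem measurableSet_Ico] with x hx
    by_cases hxe : h x = H x
    · rw [hxe]
      exact (ofReal_div_rpow_self_add_tangent (hA x hx) (hH x hx) hp).le
    · exact (ofReal_div_rpow_add_tangent (hA x hx) (hH x hx) hp (hnonneg x hx) hxe).le
  have hae := ae_eq_of_ae_le_of_lintegral_le hle (hTint.const_mul _).lintegral_lt_top.ne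
    ((hmeas h hcont).add ((hTmeas.mul ((hcont.aemeasurable measurableSet_Ico).div
      (continuousOn_hTilde.aemeasurable measurableSet_Ico))).const_mul _).ennreal_ofReal)
    (by rw [hsum h hcont hnonneg hnorm, htotal, hobj])
  have heq : h =ᵐ[volume.restrict I] H := by
    filter_upwards [hae, ae_restrict_mem measurableSet_Ico] with x hxe hx
    by_contra hne
    exact (ofReal_div_rpow_add_tangent (hA x hx) (hH x hx) hp (hnonneg x hx) hne).ne hxe
  exact Measure.eqOn_Ico_of_ae_eq volume heq hcont continuousOn_hTilde
end

section
/- Let f : (0,1) → ℝ be analytic, in the sense that there is a sequence of reals (a_n)_{n≥0} with f(x) = Σ_{n=0}^∞ a_n·(x − 1/2)^n for every x ∈ (0,1). Then f is a proper scoring rule if and only if f is nonconstant, f′(x) ≥ 0 for all x ∈ (0,1), and there exist reals c₀ and (c_k)_{k odd} such that f(x) = c₀ + Σ_{k ≥ 1 odd} c_k·(2k + 1 − 2kx)·(x − 1/2)^k for all x ∈ (0,1). -/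
open MeasureTheory Set

noncomputable def rewardFn (f : ℝ → ℝ) : ℝ → ℝ := fun x => x * f x + (1 - x) * f (1 - x)

/-- `f` is a (strictly) proper scoring rule: for every belief `p ∈ (0,1)`,
the expected reward `x ↦ p·f(x) + (1−p)·f(1−x)` is strictly maximized over `(0,1)` at `x = p`. -/
def IsProperRule (f : ℝ → ℝ) : Prop :=
  ∀ p ∈ Set.Ioo (0:ℝ) 1, ∀ x ∈ Set.Ioo (0:ℝ) 1, x ≠ p →
    p * f x + (1 - p) * f (1 - x) < p * f p + (1 - p) * f (1 - p)

/-- `f` is a weakly proper scoring rule: for every belief `p ∈ (0,1)`,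
the expected reward `x ↦ p·f(x) + (1−p)·f(1−x)` is (weakly) maximized over `(0,1)` at `x = p`. -/
def IsWeaklyProperRule (f : ℝ → ℝ) : Prop :=
  ∀ p ∈ Set.Ioo (0:ℝ) 1, ∀ x ∈ Set.Ioo (0:ℝ) 1,
    p * f x + (1 - p) * f (1 - x) ≤ p * f p + (1 - p) * f (1 - p)

open scoped Topology

lemma hasFPowerSeriesOnBall_ofScalars_half {f : ℝ → ℝ} {a : ℕ → ℝ}
    (hf : ∀ x ∈ Ioo (0:ℝ) 1, HasSum (fun n => a n * (x - 1/2) ^ n) (f x)) :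
    HasFPowerSeriesOnBall f (FormalMultilinearSeries.ofScalars ℝ a) (1/2) (1/2 : NNReal) where
  r_le := by
    refine ENNReal.le_of_forall_nnreal_lt fun r hr => ?_
    have hr' : (r:ℝ) < 1/2 := by
      have : r < 1/2 := by exact_mod_cast hr
      exact_mod_cast this
    have h0 := r.coe_nonneg
    refine FormalMultilinearSeries.le_radius_of_summable_norm _ ?_
    have := (hf (1/2 + r) ⟨by linarith, by linarith⟩).summable.norm
    simpa [abs_of_nonneg h0] using this
  r_pos := by norm_num
  hasSum := by
    intro y hy
    have hy' : |y| < 1/2 := by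
      simpa [Metric.mem_eball, edist_dist, ENNReal.ofReal_lt_iff_lt_toReal] using hy
    rw [abs_lt] at hy'
    have := hf (1/2 + y) ⟨by linarith, by linarith⟩
    simpa [FormalMultilinearSeries.ofScalars_apply_eq, mul_comm] using this

lemma hasSum_deriv_half {f : ℝ → ℝ} {a : ℕ → ℝ}
    (hf : ∀ x ∈ Ioo (0:ℝ) 1, HasSum (fun n => a n * (x - 1/2) ^ n) (f x))
    {x : ℝ} (hx : x ∈ Ioo (0:ℝ) 1) :
    HasSum (fun n : ℕ => ((n:ℝ) + 1) * a (n + 1) * (x - 1/2) ^ n) (deriv f x) := by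
  have hmem : x - 1/2 ∈ Metric.eball (0:ℝ) (1/2 : NNReal) := by
    have : |x - 1/2| < 1/2 := abs_lt.2 ⟨by linarith [hx.1], by linarith [hx.2]⟩
    simpa [Metric.mem_eball, edist_dist, ENNReal.ofReal_lt_iff_lt_toReal] using this
  have h := (hasFPowerSeriesOnBall_ofScalars_half hf).fderiv.hasSum hmem
  have h1 := h.mapL (ContinuousLinearMap.apply ℝ ℝ (1:ℝ))
  simp only [ContinuousLinearMap.apply_apply, add_sub_cancel, fderiv_eq_smul_deriv, one_smul,
    FormalMultilinearSeries.apply_eq_pow_smul_coeff, smul_apply,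
    FormalMultilinearSeries.derivSeries_coeff_one,
    FormalMultilinearSeries.coeff_ofScalars] at h1
  refine h1.congr_fun ?_
  intro n
  simp
  ring

lemma analyticOnNhd_of_hasSum_half {f : ℝ → ℝ} {a : ℕ → ℝ}
    (hf : ∀ x ∈ Ioo (0:ℝ) 1, HasSum (fun n => a n * (x - 1/2) ^ n) (f x)) :
    AnalyticOnNhd ℝ f (Ioo 0 1) := by
  intro x hx
  refine (hasFPowerSeriesOnBall_ofScalars_half hf).analyticAt_of_mem ?_
  have : |x - 1/2| < 1/2 := abs_lt.2 ⟨by linarith [hx.1], by linarith [hx.2]⟩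
  simpa [Metric.mem_eball, edist_dist, Real.dist_eq, ENNReal.ofReal_lt_iff_lt_toReal] using this

lemma coeff_eq_of_hasSum_half {f : ℝ → ℝ} {a b : ℕ → ℝ}
    (ha : ∀ x ∈ Ioo (0:ℝ) 1, HasSum (fun n => a n * (x - 1/2) ^ n) (f x))
    (hb : ∀ x ∈ Ioo (0:ℝ) 1, HasSum (fun n => b n * (x - 1/2) ^ n) (f x)) : a = b :=
  FormalMultilinearSeries.ofScalars_series_injective ℝ ℝ <|
    (hasFPowerSeriesOnBall_ofScalars_half ha).hasFPowerSeriesAt.eq_formalMultilinearSeries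
      (hasFPowerSeriesOnBall_ofScalars_half hb).hasFPowerSeriesAt

lemma reflection_symm_iff_odd_coeff_eq_zero {h : ℝ → ℝ} {g : ℕ → ℝ}
    (hg : ∀ x ∈ Ioo (0:ℝ) 1, HasSum (fun n => g n * (x - 1/2) ^ n) (h x)) :
    (∀ x ∈ Ioo (0:ℝ) 1, h x = h (1 - x)) ↔ ∀ n, Odd n → g n = 0 := by
  have hr : ∀ x ∈ Ioo (0:ℝ) 1,
      HasSum (fun n => (-1) ^ n * g n * (x - 1/2) ^ n) (h (1 - x)) := by
    intro x hx
    refine (hg (1 - x) ⟨by linarith [hx.2], by linarith [hx.1]⟩).congr_fun fun n => ?_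
    rw [show 1 - x - 1/2 = (-1) * (x - 1/2) by ring, mul_pow]
    ring
  constructor
  · intro hs n hn
    have := coeff_eq_of_hasSum_half hg (fun x hx => (hs x hx) ▸ hr x hx)
    have := congrFun this n
    rw [hn.neg_one_pow] at this
    linarith
  · intro ho x hx
    refine (hg x hx).unique ((hr x hx).congr_fun fun n => ?_)
    rcases n.even_or_odd with hn | hn
    · simp [hn.neg_one_pow]
    · simp [ho n hn]

lemma mul_deriv_symm_iff {f : ℝ → ℝ} {a : ℕ → ℝ}
    (hf : ∀ x ∈ Ioo (0:ℝ) 1, HasSum (fun n => a n * (x - 1/2) ^ n) (f x)) :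
    (∀ x ∈ Ioo (0:ℝ) 1, x * deriv f x = (1 - x) * deriv f (1 - x)) ↔
      ∀ n : ℕ, Odd n → ((n:ℝ) + 1) * a (n + 1) + 2 * n * a n = 0 := by
  rw [← reflection_symm_iff_odd_coeff_eq_zero (h := fun x => 2 * (x * deriv f x))]
  · simp
  · intro x hx
    have h1 := hasSum_deriv_half hf hx
    have h2 : HasSum (fun n : ℕ => (n:ℝ) * a n * (x - 1/2) ^ n) ((x - 1/2) * deriv f x) := by
      rw [← hasSum_nat_add_iff' 1]
      simp only [Finset.range_one, Finset.sum_singleton, Nat.cast_zero, zero_mul, sub_zero]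
      refine (h1.mul_left (x - 1/2)).congr_fun fun n => ?_
      push_cast
      ring
    have h3 := h1.add (h2.mul_left 2)
    rw [show deriv f x + 2 * ((x - 1/2) * deriv f x) = 2 * (x * deriv f x) by ring] at h3
    exact h3.congr_fun fun n => by ring

lemma strictMonoOn_of_deriv_nonneg {f : ℝ → ℝ} (hf : AnalyticOnNhd ℝ f (Ioo 0 1))
    (hne : ∃ x ∈ Ioo (0:ℝ) 1, ∃ y ∈ Ioo (0:ℝ) 1, f x ≠ f y)
    (hd : ∀ x ∈ Ioo (0:ℝ) 1, 0 ≤ deriv f x) : StrictMonoOn f (Ioo 0 1) := by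
  have hm : MonotoneOn f (Ioo 0 1) := by
    refine monotoneOn_of_deriv_nonneg (convex_Ioo 0 1) hf.continuousOn ?_ ?_
    · rw [interior_Ioo]
      exact hf.differentiableOn
    · rwa [interior_Ioo]
  intro x hx y hy hxy
  refine lt_of_le_of_ne (hm hx hy hxy.le) fun heq => ?_
  obtain ⟨u, hu, v, hv, huv⟩ := hne
  have hz : (x + y) / 2 ∈ Ioo (0:ℝ) 1 := ⟨by linarith [hx.1, hy.1], by linarith [hx.2, hy.2]⟩
  have hev : f =ᶠ[𝓝 ((x + y) / 2)] fun _ => f x := by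
    filter_upwards [Ioo_mem_nhds (show x < (x + y) / 2 by linarith)
      (show (x + y) / 2 < y by linarith)] with t ht
    have ht' : t ∈ Ioo (0:ℝ) 1 := ⟨hx.1.trans ht.1, ht.2.trans hy.2⟩
    exact le_antisymm (heq ▸ hm ht' hy ht.2.le) (hm hx ht' ht.1.le)
  have hE := hf.eqOn_of_preconnected_of_eventuallyEq analyticOnNhd_const
    isPreconnected_Ioo hz hev
  exact huv ((hE hu).trans (hE hv).symm)

lemma hasDerivAt_expectedReward {f : ℝ → ℝ} (hf : DifferentiableOn ℝ f (Ioo 0 1)) (p : ℝ)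
    {x : ℝ} (hx : x ∈ Ioo (0:ℝ) 1) :
    HasDerivAt (fun x => p * f x + (1 - p) * f (1 - x))
      (p * deriv f x - (1 - p) * deriv f (1 - x)) x := by
  have hd : ∀ y ∈ Ioo (0:ℝ) 1, HasDerivAt f (deriv f y) y := fun y hy =>
    (hf.differentiableAt (Ioo_mem_nhds hy.1 hy.2)).hasDerivAt
  have h2 : HasDerivAt (fun x => f (1 - x)) (-deriv f (1 - x)) x :=
    (hd (1 - x) ⟨by linarith [hx.2], by linarith [hx.1]⟩).comp_const_sub 1 x
  rw [sub_eq_add_neg (p * deriv f x), ← mul_neg]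
  exact ((hd x hx).const_mul p).add (h2.const_mul (1 - p))

lemma IsProperRule.mul_deriv_symm {f : ℝ → ℝ} (hp : IsProperRule f)
    (hf : DifferentiableOn ℝ f (Ioo 0 1)) {x : ℝ} (hx : x ∈ Ioo (0:ℝ) 1) :
    x * deriv f x = (1 - x) * deriv f (1 - x) := by
  have hmax : IsLocalMax (fun y => x * f y + (1 - x) * f (1 - y)) x := by
    filter_upwards [Ioo_mem_nhds hx.1 hx.2] with y hy
    rcases eq_or_ne y x with rfl | h
    · rfl
    · exact (hp x hx y hy h).le
  linarith [hmax.hasDerivAt_eq_zero (hasDerivAt_expectedReward hf x hx)]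

lemma IsProperRule.strictMonoOn_sub {f : ℝ → ℝ} (hp : IsProperRule f) :
    StrictMonoOn (fun x => f x - f (1 - x)) (Ioo 0 1) := by
  intro x hx y hy hxy
  have h1 := hp x hx y hy hxy.ne'
  have h2 := hp y hy x hx hxy.ne
  have : 0 < (y - x) * ((f y - f (1 - y)) - (f x - f (1 - x))) := by linarith
  simpa using (pos_iff_pos_of_mul_pos this).1 (sub_pos.2 hxy)

lemma IsProperRule.deriv_nonneg {f : ℝ → ℝ} (hp : IsProperRule f)
    (hf : DifferentiableOn ℝ f (Ioo 0 1)) {x : ℝ} (hx : x ∈ Ioo (0:ℝ) 1) :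
    0 ≤ deriv f x := by
  have hx' : 1 - x ∈ Ioo (0:ℝ) 1 := ⟨by linarith [hx.2], by linarith [hx.1]⟩
  have hd : ∀ y ∈ Ioo (0:ℝ) 1, HasDerivAt f (deriv f y) y := fun y hy =>
    (hf.differentiableAt (Ioo_mem_nhds hy.1 hy.2)).hasDerivAt
  have h1 := (hd x hx).sub ((hd (1 - x) hx').comp_const_sub 1 x)
  have h2 : 0 ≤ deriv f x - -deriv f (1 - x) := by
    rw [← h1.deriv, ← derivWithin_of_mem_nhds (Ioo_mem_nhds hx.1 hx.2)]
    exact hp.strictMonoOn_sub.monotoneOn.derivWithin_nonneg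
  have h3 := hp.mul_deriv_symm hf hx
  have h4 := mul_nonneg hx'.1.le h2
  linarith

lemma IsProperRule.exists_ne {f : ℝ → ℝ} (hp : IsProperRule f) :
    ∃ x ∈ Ioo (0:ℝ) 1, ∃ y ∈ Ioo (0:ℝ) 1, f x ≠ f y := by
  refine ⟨1/4, by norm_num, 3/4, by norm_num, fun h => ?_⟩
  have := hp (1/4) (by norm_num) (3/4) (by norm_num) (by norm_num)
  norm_num [h] at this

lemma mul_sub_le_expectedReward_sub {f : ℝ → ℝ} (hf : DifferentiableOn ℝ f (Ioo 0 1))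
    (hd : ∀ x ∈ Ioo (0:ℝ) 1, 0 ≤ deriv f x)
    (hs : ∀ x ∈ Ioo (0:ℝ) 1, x * deriv f x = (1 - x) * deriv f (1 - x))
    {p x y : ℝ} (hx : x ∈ Ioo (0:ℝ) 1) (hy : y ∈ Ioo (0:ℝ) 1) (hxy : x ≤ y) (hyp : y ≤ p) :
    (p - y) * (f y - f x) ≤
      (p * f y + (1 - p) * f (1 - y)) - (p * f x + (1 - p) * f (1 - x)) := by
  have hsub : Icc x y ⊆ Ioo 0 1 := Icc_subset_Ioo hx.1 hy.2
  have hder : ∀ t ∈ Icc x y,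
      HasDerivAt (fun t => (p * f t + (1 - p) * f (1 - t)) - (p - y) * f t)
        (p * deriv f t - (1 - p) * deriv f (1 - t) - (p - y) * deriv f t) t := fun t ht =>
    (hasDerivAt_expectedReward hf p (hsub ht)).sub
      (((hf.differentiableAt (Ioo_mem_nhds (hsub ht).1 (hsub ht).2)).hasDerivAt).const_mul _)
  have hmono : MonotoneOn (fun t => (p * f t + (1 - p) * f (1 - t)) - (p - y) * f t)
      (Icc x y) := by
    refine monotoneOn_of_hasDerivWithinAt_nonneg (convex_Icc x y)
      (fun t ht => (hder t ht).continuousAt.continuousWithinAt)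
      (fun t ht => (hder t (interior_subset ht)).hasDerivWithinAt) fun t ht => ?_
    have ht' := interior_subset ht
    obtain ⟨ht0, ht1⟩ := hsub ht'
    have hst := hs t ⟨ht0, ht1⟩
    have hpos : 0 ≤ p - t - (p - y) * (1 - t) := by nlinarith [ht'.2]
    refine nonneg_of_mul_nonneg_right (b := _) (a := 1 - t) ?_ (by linarith)
    have := mul_nonneg (hd t ⟨ht0, ht1⟩) hpos
    linear_combination this - (1 - p) * hst
  have := hmono (left_mem_Icc.2 hxy) (right_mem_Icc.2 hxy) hxy
  dsimp only at this
  linarith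

lemma isProperRule_of_mul_deriv_symm {f : ℝ → ℝ} (hf : DifferentiableOn ℝ f (Ioo 0 1))
    (hm : StrictMonoOn f (Ioo 0 1)) (hd : ∀ x ∈ Ioo (0:ℝ) 1, 0 ≤ deriv f x)
    (hs : ∀ x ∈ Ioo (0:ℝ) 1, x * deriv f x = (1 - x) * deriv f (1 - x)) :
    IsProperRule f := by
  have key : ∀ p ∈ Ioo (0:ℝ) 1, ∀ x ∈ Ioo (0:ℝ) 1, x < p →
      p * f x + (1 - p) * f (1 - x) < p * f p + (1 - p) * f (1 - p) := by
    intro p hp x hx hxp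
    have hmid : (x + p) / 2 ∈ Ioo (0:ℝ) 1 := ⟨by linarith [hx.1, hp.1], by linarith [hx.2, hp.2]⟩
    have h1 := mul_sub_le_expectedReward_sub hf hd hs (p := p) hx hmid
      (by linarith) (by linarith)
    have h2 := mul_sub_le_expectedReward_sub hf hd hs (p := p) hmid hp
      (by linarith) le_rfl
    have h3 : 0 < (p - (x + p) / 2) * (f ((x + p) / 2) - f x) :=
      mul_pos (by linarith) (sub_pos.2 (hm hx hmid (by linarith)))
    linarith
  intro p hp x hx hne
  rcases lt_or_gt_of_ne hne with h | h
  · exact key p hp x hx h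
  · have := key (1 - p) ⟨by linarith [hp.2], by linarith [hp.1]⟩ (1 - x)
      ⟨by linarith [hx.2], by linarith [hx.1]⟩ (by linarith)
    simp only [sub_sub_cancel] at this
    linarith

lemma hasSum_odd_grouping {a : ℕ → ℝ} {s z : ℝ} (h : HasSum (fun n => a n * z ^ n) s) :
    HasSum (fun k => {n | Odd n}.indicator (fun n => a n * z ^ n + a (n + 1) * z ^ (n + 1)) k)
      (s - a 0) := by
  have ho := (h.summable.indicator {k | Odd k}).hasSum
  have he := h.sub ho
  rw [← hasSum_nat_add_iff' 1] at he
  have := ho.add he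
  rw [show s - a 0 = _ + _ by
    simpa using (by ring : s - a 0 = (∑' n, {k | Odd k}.indicator (fun n => a n * z ^ n) n) +
      (s - (∑' n, {k | Odd k}.indicator (fun n => a n * z ^ n) n) - a 0))]
  refine HasSum.congr_fun (by simpa using this) fun k => ?_
  by_cases hk : Odd k
  · simp [hk, Set.indicator, Nat.odd_add_one]
  · simp [hk, Set.indicator, Nat.odd_add_one]

lemma hasSum_ungroup {c : ℕ → ℝ} {φ : ℝ → ℝ} (h0 : c 0 = 0)
    (h : ∀ x ∈ Ioo (0:ℝ) 1, HasSum (fun k : ℕ =>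
      c k * (2 * (k:ℝ) + 1 - 2 * (k:ℝ) * x) * (x - 1/2) ^ k) (φ x))
    {x : ℝ} (hx : x ∈ Ioo (0:ℝ) 1) :
    HasSum (fun n : ℕ => (((n:ℝ) + 1) * c n - 2 * ((n:ℝ) - 1) * c (n - 1)) * (x - 1/2) ^ n)
      (φ x) := by
  have hz : |x - 1/2| < 1/2 := abs_lt.2 ⟨by linarith [hx.1], by linarith [hx.2]⟩
  have hw := abs_nonneg (x - 1/2)
  have hs : Summable fun k : ℕ => ((k:ℝ) + 1) * c k * (x - 1/2) ^ k := by
    refine Summable.of_norm_bounded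
      (h (1/2 - |x - 1/2|) ⟨by linarith, by linarith⟩).summable.norm fun k => ?_
    have hk : (0:ℝ) ≤ k := k.cast_nonneg
    have hkw := mul_nonneg hk hw
    rw [norm_mul, norm_mul, norm_mul, norm_mul, mul_comm ‖(k:ℝ) + 1‖, norm_pow, norm_pow,
      show ‖1/2 - |x - 1/2| - 1/2‖ = ‖x - 1/2‖ by simp]
    gcongr
    rw [Real.norm_of_nonneg (by linarith), Real.norm_of_nonneg (by linarith)]
    linarith
  have h2 := hs.hasSum.sub (h x hx)
  have h3 : HasSum (fun n : ℕ => 2 * ((n:ℝ) - 1) * c (n - 1) * (x - 1/2) ^ n)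
      ((∑' k : ℕ, ((k:ℝ) + 1) * c k * (x - 1/2) ^ k) - φ x) := by
    rw [← hasSum_nat_add_iff' 1]
    simp only [Finset.range_one, Finset.sum_singleton, zero_tsub, h0, mul_zero, zero_mul, sub_zero]
    refine h2.congr_fun fun n => ?_
    simp only [Nat.add_sub_cancel]
    push_cast
    ring
  have h4 := hs.hasSum.sub h3
  rw [sub_sub_cancel] at h4
  exact h4.congr_fun fun n => by ring

theorem analytic_proper_characterization (f : ℝ → ℝ) (a : ℕ → ℝ)
    (hf : ∀ x ∈ Set.Ioo (0:ℝ) 1, HasSum (fun n => a n * (x - 1/2) ^ n) (f x)) :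
    IsProperRule f ↔
      ((∃ x ∈ Set.Ioo (0:ℝ) 1, ∃ y ∈ Set.Ioo (0:ℝ) 1, f x ≠ f y) ∧
        (∀ x ∈ Set.Ioo (0:ℝ) 1, 0 ≤ deriv f x) ∧
        ∃ c₀ : ℝ, ∃ c : ℕ → ℝ, (∀ k, Even k → c k = 0) ∧
          ∀ x ∈ Set.Ioo (0:ℝ) 1,
            HasSum (fun k : ℕ =>
              c k * (2 * (k:ℝ) + 1 - 2 * (k:ℝ) * x) * (x - 1/2) ^ k) (f x - c₀)) := by
  have han := analyticOnNhd_of_hasSum_half hf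
  have hdiff := han.differentiableOn
  constructor
  · intro hp
    refine ⟨hp.exists_ne, fun x hx => hp.deriv_nonneg hdiff hx, a 0,
      {n | Odd n}.indicator fun k => a k / ((k:ℝ) + 1), fun k hk => ?_, fun x hx => ?_⟩
    · simp [hk]
    · have hrel := (mul_deriv_symm_iff hf).1 fun x hx => hp.mul_deriv_symm hdiff hx
      refine (hasSum_odd_grouping (hf x hx)).congr_fun fun k => ?_
      by_cases hk : Odd k
      · have hk1 : (k:ℝ) + 1 ≠ 0 := by positivity
        have hak : a (k + 1) = -(2 * k * a k) / ((k:ℝ) + 1) := by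
          rw [eq_div_iff hk1]
          linarith [hrel k hk]
        simp only [Set.indicator, Set.mem_ofPred_eq, hk, if_true, hak]
        field_simp
        ring
      · simp [Set.indicator, hk]
  · rintro ⟨hne, hd, c₀, c, hc, hsum⟩
    refine isProperRule_of_mul_deriv_symm hdiff (strictMonoOn_of_deriv_nonneg han hne hd) hd ?_
    rw [mul_deriv_symm_iff hf]
    have hc0 : c 0 = 0 := hc 0 Even.zero
    have hsub : ∀ x ∈ Ioo (0:ℝ) 1, HasSum
        (fun n => (a n - (if n = 0 then c₀ else 0)) * (x - 1/2) ^ n) (f x - c₀) := by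
      intro x hx
      refine ((hf x hx).sub (hasSum_ite_eq 0 c₀)).congr_fun fun n => ?_
      rcases eq_or_ne n 0 with rfl | hn
      · simp
      · simp [hn]
    have hcoef := coeff_eq_of_hasSum_half hsub fun x hx => hasSum_ungroup hc0 hsum hx
    intro n hn
    have h1 := congrFun hcoef n
    have h2 := congrFun hcoef (n + 1)
    have hn0 : n ≠ 0 := hn.pos.ne'
    simp only [hn0, if_false, sub_zero, hc (n - 1) (Nat.Odd.sub_odd hn odd_one), mul_zero] at h1
    simp only [Nat.add_eq_zero_iff, one_ne_zero, and_false, if_false, sub_zero,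
      hc (n + 1) hn.add_one, mul_zero, Nat.add_sub_cancel] at h2
    rw [h1, h2]
    push_cast
    ring
end
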